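/- arXiv:2504.21057 — 2 statements merged into one kernel-verified Lean document; each statement's English description precedes it below -/
import Mathlib

section
/- Let f, g : S → ℂ satisfy the integral Kannappan-sine subtraction law ∫_S f(xσ(y)t) dμ(t) = f(x)g(y) − f(y)g(x) for all x, y ∈ S, and suppose f and g are linearly independent over ℂ. Then for all x, y ∈ S: f(xσ(y)) · ∫_S ∫_S g(σ(s)k) dμ(k)dμ(s) = [f(x)g(y) − f(y)g(x)] · ∫_S g(k) dμ(k) + g(xσ(y)) · ∫_S ∫_S f(σ(s)k) dμ(k)dμ(s). -/
/-- Integral of `h` against a finitely supported complex measure `μ` on `S`: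
`∫_S h(t) dμ(t) = Σ_t μ(t) h(t)`. -/
noncomputable def mint {S : Type*} (μ : S →₀ ℂ) (h : S → ℂ) : ℂ :=
  μ.sum fun t c => c * h t

theorem mint_add {S : Type*} (μ : S →₀ ℂ) (h k : S → ℂ) :
    mint μ (fun t => h t + k t) = mint μ h + mint μ k := by
  simp only [mint, Finsupp.sum, mul_add, Finset.sum_add_distrib]

theorem mint_sub {S : Type*} (μ : S →₀ ℂ) (h k : S → ℂ) :
    mint μ (fun t => h t - k t) = mint μ h - mint μ k := by
  simp only [mint, Finsupp.sum, mul_sub, Finset.sum_sub_distrib]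

theorem mint_const_mul {S : Type*} (μ : S →₀ ℂ) (c : ℂ) (h : S → ℂ) :
    mint μ (fun t => c * h t) = c * mint μ h := by
  simp only [mint, Finsupp.sum, Finset.mul_sum, mul_left_comm]

theorem mint_mul_const {S : Type*} (μ : S →₀ ℂ) (c : ℂ) (h : S → ℂ) :
    mint μ (fun t => h t * c) = mint μ h * c := by
  simp only [mint, Finsupp.sum, Finset.sum_mul, mul_assoc]

theorem mint_comm {S : Type*} (μ : S →₀ ℂ) (h : S → S → ℂ) :
    mint μ (fun s => mint μ (fun k => h s k)) = mint μ (fun k => mint μ (fun s => h s k)) := by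
  simp only [mint, Finsupp.sum, Finset.mul_sum]
  rw [Finset.sum_comm]
  simp only [mul_left_comm]

/-- Two linearly independent functions have a nonvanishing `2 × 2` minor. -/
theorem exists_minor_ne_zero {S : Type*} {f g : S → ℂ}
    (hli : ∀ a b : ℂ, (∀ x : S, a * f x + b * g x = 0) → a = 0 ∧ b = 0) :
    ∃ u v : S, f u * g v - f v * g u ≠ 0 := by
  by_contra! h
  have h0 : ∀ u, f u = 0 := fun u => by
    have := (hli (-g u) (f u) fun v => by linear_combination h u v).2
    exact this
  exact one_ne_zero (hli 1 0 fun x => by simp [h0 x]).1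

/-- Comparison of coefficients for linearly independent functions. -/
theorem coeff_eq {S : Type*} {f g : S → ℂ}
    (hli : ∀ a b : ℂ, (∀ x : S, a * f x + b * g x = 0) → a = 0 ∧ b = 0)
    {a b c d : ℂ} (h : ∀ x, a * f x + b * g x = c * f x + d * g x) : a = c ∧ b = d := by
  have := hli (a - c) (b - d) fun x => by linear_combination h x
  exact ⟨sub_eq_zero.1 this.1, sub_eq_zero.1 this.2⟩

section SubtractionLaw

variable {S : Type*} [Semigroup S] {σ : S → S} {μ : S →₀ ℂ} {f g : S → ℂ}

/-- Left multiplication by `y` is adjoint to right multiplication by `σ y` for the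
alternating form `f x * g y - f y * g x`. -/
theorem minor_mul_left (hσmul : ∀ x y : S, σ (x * y) = σ x * σ y)
    (hf : ∀ x y : S, mint μ (fun t => f (x * σ y * t)) = f x * g y - f y * g x) (x y z : S) :
    f x * g (y * z) - f (y * z) * g x = f (x * σ y) * g z - f z * g (x * σ y) := by
  rw [← hf, ← hf, hσmul, mul_assoc x]

/-- The span of `f` and `g` is invariant under right translations. -/
theorem exists_right_translation_coeff (hσmul : ∀ x y : S, σ (x * y) = σ x * σ y)
    (hσinv : ∀ x : S, σ (σ x) = x)
    (hf : ∀ x y : S, mint μ (fun t => f (x * σ y * t)) = f x * g y - f y * g x)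
    {u v : S} (huv : f u * g v - f v * g u ≠ 0) :
    ∃ A B C E : S → ℂ, ∀ x y, f (x * y) = A y * f x + B y * g x ∧
      g (x * y) = C y * f x + E y * g x := by
  set D := f u * g v - f v * g u with hD
  refine ⟨fun y => (f u * g (σ y * v) - f v * g (σ y * u)) / D,
    fun y => (f v * f (σ y * u) - f u * f (σ y * v)) / D,
    fun y => (g u * g (σ y * v) - g v * g (σ y * u)) / D,
    fun y => (g v * f (σ y * u) - g u * f (σ y * v)) / D, fun x y => ?_⟩
  have h1 := minor_mul_left hσmul hf x (σ y) u
  have h2 := minor_mul_left hσmul hf x (σ y) v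
  rw [hσinv] at h1 h2
  constructor
  · field_simp
    rw [hD]
    linear_combination f v * h1 - f u * h2
  · field_simp
    rw [hD]
    linear_combination g v * h1 - g u * h2

/-- A linearly independent solution `f` has integral zero. -/
theorem mint_eq_zero (hσmul : ∀ x y : S, σ (x * y) = σ x * σ y)
    (hσinv : ∀ x : S, σ (σ x) = x)
    (hf : ∀ x y : S, mint μ (fun t => f (x * σ y * t)) = f x * g y - f y * g x)
    (hli : ∀ a b : ℂ, (∀ x : S, a * f x + b * g x = 0) → a = 0 ∧ b = 0) :
    mint μ f = 0 := by
  obtain ⟨u, v, huv⟩ := exists_minor_ne_zero hli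
  have adj := minor_mul_left hσmul hf
  obtain ⟨A, B, C, E, hR⟩ := exists_right_translation_coeff hσmul hσinv hf huv
  set a := mint μ f with ha
  set b := mint μ g with hb
  obtain ⟨α, hα⟩ : ∃ α, α = mint μ A := ⟨_, rfl⟩
  obtain ⟨β, hβ⟩ : ∃ β, β = mint μ B := ⟨_, rfl⟩
  obtain ⟨γ, hγ⟩ : ∃ γ, γ = mint μ C := ⟨_, rfl⟩
  obtain ⟨δ, hδ⟩ : ∃ δ, δ = mint μ E := ⟨_, rfl⟩
  obtain ⟨p, hp⟩ : ∃ p, p = mint μ (fun s => A (σ s)) := ⟨_, rfl⟩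
  obtain ⟨q, hq⟩ : ∃ q, q = mint μ (fun s => B (σ s)) := ⟨_, rfl⟩
  obtain ⟨r, hr⟩ : ∃ r, r = mint μ (fun s => C (σ s)) := ⟨_, rfl⟩
  obtain ⟨w, hw⟩ : ∃ w, w = mint μ (fun s => E (σ s)) := ⟨_, rfl⟩
  have fm : ∀ x, mint μ (fun t => f (x * t)) = α * f x + β * g x := fun x => by
    simp only [(hR _ _).1, mint_add, mint_mul_const, hα, hβ]
  have gm : ∀ x, mint μ (fun t => g (x * t)) = γ * f x + δ * g x := fun x => by
    simp only [(hR _ _).2, mint_add, mint_mul_const, hγ, hδ]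
  have fm' : ∀ x, mint μ (fun t => f (x * σ t)) = p * f x + q * g x := fun x => by
    simp only [(hR _ _).1, mint_add, mint_mul_const, hp, hq]
  have gm' : ∀ x, mint μ (fun t => g (x * σ t)) = r * f x + w * g x := fun x => by
    simp only [(hR _ _).2, mint_add, mint_mul_const, hr, hw]
  have left : ∀ z, mint μ (fun t => g (t * z)) = p * g z - r * f z ∧
      - mint μ (fun t => f (t * z)) = q * g z - w * f z := fun z => by
    refine coeff_eq hli fun x => ?_
    have h := congrArg (mint μ) (funext fun t => adj x t z)
    simp only [mint_sub, mint_mul_const, mint_const_mul, fm', gm'] at h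
    linear_combination h
  have gl : ∀ z, mint μ (fun t => g (t * z)) = p * g z - r * f z := fun z => (left z).1
  have fl : ∀ z, mint μ (fun t => f (t * z)) = w * f z - q * g z := fun z => by
    linear_combination - (left z).2
  obtain ⟨e1, e2⟩ : α * p + β * r = b ∧ α * q + β * w = -a := by
    refine coeff_eq hli fun x => ?_
    have h := congrArg (mint μ) (funext fun s => hf x s)
    simp only [fm, mint_add, mint_sub, mint_mul_const, mint_const_mul, fm', gm'] at h
    linear_combination h
  have inv : ∃ c d c' d' : ℂ, (c * p + d * r = 1 ∧ c * q + d * w = 0) ∧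
      (c' * p + d' * r = 0 ∧ c' * q + d' * w = 1) := by
    set D := f u * g v - f v * g u with hD
    refine ⟨(f u * A v - f v * A u) / D, (f u * B v - f v * B u) / D,
      (f u * C v - f v * C u) / D, (f u * E v - f v * E u) / D, ?_⟩
    set c := (f u * A v - f v * A u) / D with hc
    set d := (f u * B v - f v * B u) / D with hd
    set c' := (f u * C v - f v * C u) / D with hc'
    set d' := (f u * E v - f v * E u) / D with hd'
    have key : ∀ x z s, f z * (c' * f (x * σ s) + d' * g (x * σ s))
        - g z * (c * f (x * σ s) + d * g (x * σ s)) = f (z * σ x * s) := fun x z s => by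
      have h1 := adj z (x * σ s) u
      have h2 := adj z (x * σ s) v
      rw [hσmul, hσinv, ← mul_assoc, (hR (x * σ s) _).1, (hR (x * σ s) _).2] at h1 h2
      rw [hc, hd, hc', hd']
      field_simp
      rw [hD]
      linear_combination f u * h2 - f v * h1
    have key' : ∀ x,
        c' * (p * f x + q * g x) + d' * (r * f x + w * g x) = g x ∧
        -(c * (p * f x + q * g x) + d * (r * f x + w * g x)) = -f x := fun x => by
      refine coeff_eq hli fun z => ?_
      have h := congrArg (mint μ) (funext fun s => key x z s)
      simp only [hf, mint_add, mint_sub, mint_const_mul, fm', gm'] at h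
      linear_combination h
    exact ⟨coeff_eq hli fun x => by linear_combination - (key' x).2,
      coeff_eq hli fun x => by linear_combination (key' x).1⟩
  have det : p * w - q * r ≠ 0 := by
    obtain ⟨c, d, c', d', ⟨h1, h2⟩, h3, h4⟩ := inv
    intro h0
    refine one_ne_zero (α := ℂ) ?_
    linear_combination (c * d' - d * c') * h0 - (c * p + d * r) * h4 - h1
      + (c * q + d * w) * h3
  obtain ⟨k1, k2⟩ : w * α - q * γ = α * w - β * r ∧ w * β - q * δ = β * p - α * q := by
    refine coeff_eq hli fun z => ?_
    have h := mint_comm μ fun s k => f (s * z * k)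
    simp only [fm, mint_add, mint_const_mul, fl, gl] at h
    simp only [mul_assoc, fl, mint_sub, mint_const_mul, fm, gm] at h
    linear_combination -h
  have k3 : p * γ - r * α = γ * w - δ * r := by
    refine (coeff_eq (b := p * δ - r * β) (d := δ * p - γ * q) hli fun z => ?_).1
    have h := mint_comm μ fun s k => g (s * z * k)
    simp only [gm, mint_add, mint_const_mul, fl, gl] at h
    simp only [mul_assoc, gl, mint_sub, mint_const_mul, fm, gm] at h
    linear_combination -h
  have m1 : α * a + β * b = w * a - q * b := by
    have h := mint_comm μ fun s k => f (s * k)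
    simpa only [fm, fl, mint_add, mint_sub, mint_const_mul] using h
  have m2 : γ * a + δ * b = p * b - r * a := by
    have h := mint_comm μ fun s k => g (s * k)
    simpa only [gm, gl, mint_add, mint_sub, mint_const_mul] using h
  have n1 : w * a - q * (b - (δ * α - γ * β)) = 0 := by
    linear_combination -m1 + α * e2 - β * e1 - α * k2 + β * k1
  have n2 : p * (b - (δ * α - γ * β)) - r * a = 0 := by
    linear_combination -m2 + γ * e2 - δ * e1 + β * k3 + α * k1
  refine (mul_eq_zero.1 (?_ : (p * w - q * r) * a = 0)).resolve_left det
  linear_combination p * n1 + q * n2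

end SubtractionLaw

theorem stmt_4 {S : Type*} [Semigroup S] (σ : S → S)
    (hσmul : ∀ x y : S, σ (x * y) = σ x * σ y) (hσinv : ∀ x : S, σ (σ x) = x)
    (μ : S →₀ ℂ) (f g : S → ℂ)
    (hf : ∀ x y : S, mint μ (fun t => f (x * σ y * t)) = f x * g y - f y * g x)
    (hli : ∀ a b : ℂ, (∀ x : S, a * f x + b * g x = 0) → a = 0 ∧ b = 0) :
    ∀ x y : S,
      f (x * σ y) * mint μ (fun s => mint μ (fun k => g (σ s * k)))
        = (f x * g y - f y * g x) * mint μ g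
          + g (x * σ y) * mint μ (fun s => mint μ (fun k => f (σ s * k))) := by
  have h0 : mint μ f = 0 := mint_eq_zero hσmul hσinv hf hli
  have adj := minor_mul_left hσmul hf
  obtain ⟨u, v, huv⟩ := exists_minor_ne_zero hli
  obtain ⟨x₀, hx₀⟩ : ∃ x, f x ≠ 0 := by
    by_contra! h
    exact huv (by simp [h])
  intro x y
  have hG : mint μ (fun s => mint μ (fun k => g (y * σ s * k))) = g y * mint μ g := by
    have h := congrArg (mint μ) (funext fun s => congrArg (mint μ)
      (funext fun k => adj x₀ (y * σ s) k))
    simp only [hσmul, hσinv, ← mul_assoc, hf, mint_sub, mint_const_mul, mint_mul_const, h0] at h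
    refine mul_left_cancel₀ hx₀ ?_
    linear_combination h
  have h := congrArg (mint μ) (funext fun s => congrArg (mint μ)
    (funext fun k => adj x y (σ s * k)))
  simp only [← mul_assoc, hf, mint_sub, mint_const_mul, mint_mul_const, h0, hG] at h
  linear_combination -h
end

section
/- Let γ ∈ ℂ\{0}, let χ be an exponential on S with χ∘σ = χ and ∫_S χ(t) dμ(t) ≠ 0, and let φ : S → ℂ be a nonzero function satisfying φ(xy) = φ(x)χ(y) + χ(x)φ(y) for all x, y ∈ S, with φ∘σ = −φ and ∫_S φ(t) dμ(t) = (∫_S χ(t) dμ(t))². Then f := (1/γ)(χ − φ/∫_S χ(t) dμ(t)) and g := φ satisfy ∫_S f(xσ(y)t) dμ(t) = f(x)g(y) − f(y)g(x) for all x, y ∈ S. -/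
theorem mint_linear_combination {S : Type*} (μ : S →₀ ℂ) (a b : ℂ) (h k : S → ℂ) :
    mint μ (fun t => a * h t + b * k t) = a * mint μ h + b * mint μ k := by
  simp only [mint, Finsupp.sum, Finset.mul_sum, ← Finset.sum_add_distrib]
  exact Finset.sum_congr rfl fun t _ => by ring

theorem stmt_9 {S : Type*} [Semigroup S] (σ : S → S)
    (hσmul : ∀ x y : S, σ (x * y) = σ x * σ y) (hσinv : ∀ x : S, σ (σ x) = x)
    (μ : S →₀ ℂ) (γ : ℂ) (hγ : γ ≠ 0)
    (χ : S → ℂ) (hχmul : ∀ x y : S, χ (x * y) = χ x * χ y) (hχ0 : χ ≠ 0)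
    (hχσ : ∀ x : S, χ (σ x) = χ x) (hχint : mint μ χ ≠ 0)
    (φ : S → ℂ) (hφ0 : φ ≠ 0)
    (hφadd : ∀ x y : S, φ (x * y) = φ x * χ y + χ x * φ y)
    (hφσ : ∀ x : S, φ (σ x) = -φ x)
    (hφint : mint μ φ = (mint μ χ) ^ 2)
    (f g : S → ℂ)
    (hfdef : f = fun x => (1 / γ) * (χ x - φ x / mint μ χ))
    (hgdef : g = φ) :
    ∀ x y : S, mint μ (fun t => f (x * σ y * t)) = f x * g y - f y * g x := by
  intro x y
  subst hfdef hgdef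
  have hφxy : g (x * σ y) = g x * χ y - χ x * g y := by
    rw [hφadd, hχσ, hφσ]; ring
  have hχxy : χ (x * σ y) = χ x * χ y := by rw [hχmul, hχσ]
  have expand : (fun t => (1 / γ) * (χ (x * σ y * t) - g (x * σ y * t) / mint μ χ)) =
      fun t => (1 / γ) * (χ x * χ y - (g x * χ y - χ x * g y) / mint μ χ) * χ t +
        -(1 / γ) * (χ x * χ y / mint μ χ) * g t := by
    funext t
    rw [hχmul (x * σ y), hφadd (x * σ y), hφxy, hχxy]
    ring
  rw [expand, mint_linear_combination, hφint]
  field_simp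
  ring
end
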